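/- Suppose k = 2^m for some natural number m, the family system F is monotone and has the merge property, and there exists at least one feasible rate function. Let ρ ≥ 1, set m_0 = 1 and m_j = 2^{j-1}+1 for 1 ≤ j ≤ m, and suppose that for each j ∈ {0,…,m} there is a set A_j ∈ F(m_j) with w(A_j) ≤ ρ·w(A) for every A ∈ F(m_j) (a ρ-approximate minimizer). Then there exists a feasible rate function R with weight(R) ≤ 4ρ·weight(R*) for every feasible rate function R*. -/

import Mathlib

/-- A rate function `R : E → {0,1,…,k}` is feasible for the family system `F` if
`R` takes values in `{0,…,k}` and, for every `i ∈ {1,…,k}`, the set of edges of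
rate at least `i` belongs to `F i`. -/
def FeasibleRate {E : Type*} (k : ℕ) (F : ℕ → Set (Set E)) (R : E → ℕ) : Prop :=
  (∀ e, R e ≤ k) ∧ ∀ i, 1 ≤ i → i ≤ k → {e | i ≤ R e} ∈ F i

/-- The weight of a rate function: `weight(R) = Σ_{e ∈ E} R(e)·w(e)`. -/
noncomputable def rateWeight {E : Type*} [Fintype E] (w : E → ℝ) (R : E → ℕ) : ℝ :=
  ∑ e, (R e : ℝ) * w e

/-- The weight of a subset of edges: `w(S) = Σ_{e ∈ S} w(e)`. -/
noncomputable def setWeight {E : Type*} [Fintype E] (w : E → ℝ) (A : Set E) : ℝ :=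
  ∑ e ∈ A.toFinite.toFinset, w e

/-- `m_0 = 1` and `m_j = 2^{j-1} + 1` for `j ≥ 1`. -/
def mIdx (j : ℕ) : ℕ := if j = 0 then 1 else 2 ^ (j - 1) + 1

open Classical in
theorem setWeight_eq_sum_ite {E : Type*} [Fintype E] (w : E → ℝ) (A : Set E) :
    setWeight w A = ∑ e, if e ∈ A then w e else 0 := by
  rw [setWeight, ← Finset.sum_filter]
  congr 1
  ext e
  simp

theorem mIdx_succ (j : ℕ) : mIdx (j + 1) = 2 ^ j + 1 := by simp [mIdx]

theorem one_le_mIdx (j : ℕ) : 1 ≤ mIdx j := by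
  unfold mIdx
  split_ifs <;> simp

theorem mIdx_le_two_pow (j : ℕ) : mIdx j ≤ 2 ^ j := by
  cases j with
  | zero => simp [mIdx]
  | succ n =>
    have := Nat.one_le_two_pow (n := n)
    rw [mIdx_succ, pow_succ]
    omega

theorem two_pow_succ_le_four_mul_mIdx (j : ℕ) : 2 ^ (j + 1) ≤ 4 * mIdx j := by
  cases j with
  | zero => simp [mIdx]
  | succ n =>
    rw [mIdx_succ, pow_succ, pow_succ]
    omega

theorem sum_two_pow_lt (n : ℕ) : ∑ l ∈ Finset.range n, 2 ^ l < 2 ^ n := by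
  induction n with
  | zero => simp
  | succ n ih =>
    rw [Finset.sum_range_succ, pow_succ]
    omega

/-- The powers `2 ^ l` whose index `mIdx l` is at most `r` add up to at most `4 * r`. -/
theorem sum_two_pow_mIdx_le (r n : ℕ) :
    ∑ l ∈ Finset.range n, (if mIdx l ≤ r then 2 ^ l else 0) ≤ 4 * r := by
  induction n with
  | zero => simp
  | succ n ih =>
    by_cases h : mIdx n ≤ r
    · calc ∑ l ∈ Finset.range (n + 1), (if mIdx l ≤ r then 2 ^ l else 0)
          ≤ ∑ l ∈ Finset.range (n + 1), 2 ^ l :=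
            Finset.sum_le_sum fun l _ => by split_ifs <;> simp
        _ ≤ 2 ^ (n + 1) := (sum_two_pow_lt _).le
        _ ≤ 4 * mIdx n := two_pow_succ_le_four_mul_mIdx n
        _ ≤ 4 * r := by omega
    · rw [Finset.sum_range_succ, if_neg h, add_zero]
      exact ih

/-- Merging the sets `A m, A (m - 1), …, A j` successively gives a rate function which is feasible
from level `mIdx j` on, and whose positive values are bounded by `2 ^ l` for some `A l`
containing the edge. -/
theorem exists_rate_feasible_above {E : Type*} (m : ℕ) (F : ℕ → Set (Set E))
    (hmono : ∀ i j, 1 ≤ i → i ≤ j → j ≤ 2 ^ m → F i ⊆ F j)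
    (hmerge : ∀ i j, 1 ≤ i → i < j → j ≤ 2 ^ m → ∀ A ∈ F i, ∀ B ∈ F j,
      ∃ C ∈ F i, B ⊆ C ∧ C ⊆ A ∪ B)
    (A : ℕ → Set E) (hA : ∀ j ≤ m, A j ∈ F (mIdx j)) {j : ℕ} (hj : j ≤ m) :
    ∃ R : E → ℕ, (∀ e, R e = 0 ∨ ∃ l ≤ m, e ∈ A l ∧ R e ≤ 2 ^ l) ∧
      ∀ i, mIdx j ≤ i → i ≤ 2 ^ m → {e | i ≤ R e} ∈ F i := by
  classical
  induction hj using Nat.decreasingInduction with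
  | self =>
    refine ⟨fun e => if e ∈ A m then 2 ^ m else 0, fun e => ?_, fun i hi him => ?_⟩
    · by_cases h : e ∈ A m
      · exact Or.inr ⟨m, le_rfl, h, by simp [h]⟩
      · simp [h]
    · have h1 := one_le_mIdx m
      have hset : {e | i ≤ if e ∈ A m then 2 ^ m else 0} = A m := by
        ext e
        by_cases h : e ∈ A m
        · simp [h, him]
        · simp only [Set.mem_ofPred_eq, h, if_false, iff_false]
          omega
      rw [hset]
      exact hmono _ _ h1 hi him (hA m le_rfl)
  | of_succ j hj ih =>
    obtain ⟨R, hR, hF⟩ := ih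
    have h1 := one_le_mIdx j
    have hle := mIdx_le_two_pow j
    have hs := mIdx_succ j
    have htop : mIdx (j + 1) ≤ 2 ^ m :=
      (mIdx_le_two_pow _).trans (Nat.pow_le_pow_right (by norm_num) hj)
    obtain ⟨C, hC, hBC, hCA⟩ := hmerge (mIdx j) (mIdx (j + 1)) h1 (by omega) htop
      (A j) (hA j (by omega)) _ (hF _ le_rfl htop)
    refine ⟨fun e => if mIdx (j + 1) ≤ R e then R e else if e ∈ C then 2 ^ j else 0,
      fun e => ?_, fun i hi him => ?_⟩
    · by_cases hB : mIdx (j + 1) ≤ R e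
      · simpa only [hB, if_true] using hR e
      · by_cases hc : e ∈ C
        · exact Or.inr ⟨j, by omega, (hCA hc).resolve_right hB, by simp [hB, hc]⟩
        · simp [hB, hc]
    · by_cases hij : mIdx (j + 1) ≤ i
      · convert hF i hij him using 1
        ext e
        simp only [Set.mem_ofPred_eq]
        split_ifs <;> omega
      · convert hmono _ _ h1 hi him hC using 1
        ext e
        have hBe : mIdx (j + 1) ≤ R e → e ∈ C := fun h => hBC h
        simp only [Set.mem_ofPred_eq]
        split_ifs with hB hc
        · exact iff_of_true (by omega) (hBe hB)
        · exact iff_of_true (by omega) hc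
        · exact iff_of_false (by omega) hc

theorem rateWeight_le_sum_setWeight {E : Type*} [Fintype E] (w : E → ℝ) (hw : ∀ e, 0 ≤ w e)
    (m : ℕ) (A : ℕ → Set E) (R : E → ℕ)
    (hR : ∀ e, R e = 0 ∨ ∃ l ≤ m, e ∈ A l ∧ R e ≤ 2 ^ l) :
    rateWeight w R ≤ ∑ l ∈ Finset.range (m + 1), 2 ^ l * setWeight w (A l) := by
  classical
  simp_rw [setWeight_eq_sum_ite, Finset.mul_sum]
  rw [Finset.sum_comm, rateWeight]
  refine Finset.sum_le_sum fun e _ => ?_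
  have hnn : ∀ l ∈ Finset.range (m + 1), (0 : ℝ) ≤ 2 ^ l * (if e ∈ A l then w e else 0) :=
    fun l _ => mul_nonneg (by positivity) (by split_ifs <;> simp [hw])
  rcases hR e with h | ⟨l, hl, he, h⟩
  · simpa [h] using Finset.sum_nonneg hnn
  · refine le_trans ?_ (Finset.single_le_sum hnn (Finset.mem_range.2 (Nat.lt_succ_of_le hl)))
    rw [if_pos he]
    exact mul_le_mul_of_nonneg_right (by exact_mod_cast h) (hw e)

theorem sum_setWeight_le_rateWeight {E : Type*} [Fintype E] (w : E → ℝ) (hw : ∀ e, 0 ≤ w e)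
    (n : ℕ) (R : E → ℕ) :
    ∑ l ∈ Finset.range n, 2 ^ l * setWeight w {e | mIdx l ≤ R e} ≤ 4 * rateWeight w R := by
  classical
  simp_rw [setWeight_eq_sum_ite, Finset.mul_sum]
  rw [Finset.sum_comm, rateWeight, Finset.mul_sum]
  refine Finset.sum_le_sum fun e _ => ?_
  have h : ∑ l ∈ Finset.range n, (if mIdx l ≤ R e then (2 : ℝ) ^ l else 0) ≤ 4 * R e := by
    exact_mod_cast sum_two_pow_mIdx_le (R e) n
  calc _ = (∑ l ∈ Finset.range n, (if mIdx l ≤ R e then (2 : ℝ) ^ l else 0)) * w e := by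
        rw [Finset.sum_mul]
        exact Finset.sum_congr rfl fun l _ => by simp
    _ ≤ 4 * R e * w e := mul_le_mul_of_nonneg_right h (hw e)
    _ = _ := mul_assoc _ _ _

theorem stmt5 {E : Type*} [Fintype E]
    (w : E → ℝ) (hw : ∀ e, 0 ≤ w e)
    (k m : ℕ) (hk : k = 2 ^ m)
    (F : ℕ → Set (Set E))
    (hmono : ∀ i j, 1 ≤ i → i ≤ j → j ≤ k → F i ⊆ F j)
    (hmerge : ∀ i j, 1 ≤ i → i < j → j ≤ k → ∀ A ∈ F i, ∀ B ∈ F j,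
      ∃ C ∈ F i, B ⊆ C ∧ C ⊆ A ∪ B)
    (hex : ∃ R : E → ℕ, FeasibleRate k F R)
    (ρ : ℝ) (hρ : 1 ≤ ρ)
    -- for each `j ∈ {0,…,m}` there is a `ρ`-approximate minimizer `A j ∈ F (m_j)`:
    (A : ℕ → Set E)
    (hA₁ : ∀ j ≤ m, A j ∈ F (mIdx j))
    (hA₂ : ∀ j ≤ m, ∀ B ∈ F (mIdx j), setWeight w (A j) ≤ ρ * setWeight w B) :
    ∃ R : E → ℕ, FeasibleRate k F R ∧
      ∀ R' : E → ℕ, FeasibleRate k F R' →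
        rateWeight w R ≤ 4 * ρ * rateWeight w R' := by
  subst hk
  obtain ⟨R, hR, hF⟩ := exists_rate_feasible_above m F hmono hmerge A hA₁ m.zero_le
  refine ⟨R, ⟨fun e => ?_, fun i hi him => hF i hi him⟩, fun R' hR' => ?_⟩
  · rcases hR e with h | ⟨l, hl, -, h⟩
    · simp [h]
    · exact h.trans (Nat.pow_le_pow_right (by norm_num) hl)
  calc rateWeight w R ≤ ∑ l ∈ Finset.range (m + 1), 2 ^ l * setWeight w (A l) :=
        rateWeight_le_sum_setWeight w hw m A R hR
    _ ≤ ∑ l ∈ Finset.range (m + 1), 2 ^ l * (ρ * setWeight w {e | mIdx l ≤ R' e}) := by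
        refine Finset.sum_le_sum fun l hl => mul_le_mul_of_nonneg_left ?_ (by positivity)
        have hlm : l ≤ m := Nat.lt_succ_iff.1 (Finset.mem_range.1 hl)
        exact hA₂ l hlm _ (hR'.2 _ (one_le_mIdx l)
          ((mIdx_le_two_pow l).trans (Nat.pow_le_pow_right (by norm_num) hlm)))
    _ = ρ * ∑ l ∈ Finset.range (m + 1), 2 ^ l * setWeight w {e | mIdx l ≤ R' e} := by
        rw [Finset.mul_sum]
        exact Finset.sum_congr rfl fun l _ => by ring
    _ ≤ ρ * (4 * rateWeight w R') :=
        mul_le_mul_of_nonneg_left (sum_setWeight_le_rateWeight w hw _ R') (by linarith)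
    _ = 4 * ρ * rateWeight w R' := by ring
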